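/- arXiv:1908.11082 — 2 statements merged into one kernel-verified Lean document; each statement's English description precedes it below -/
import Mathlib

section
/- Mixed ℓ₂/ℓ_q error bound for the block Dantzig selector (BDS) with block k-sparse signals: let q > 1 be real, k ≥ 1, x block k-sparse, μ ≥ 0, ε with ‖Aᵀε‖_{2,∞} ≤ μ, and y = A x + ε. Let x̂ satisfy ‖Aᵀ(y − A x̂)‖_{2,∞} ≤ μ and ‖x̂‖_{2,1} ≤ ‖z‖_{2,1} for every z with ‖Aᵀ(y − A z)‖_{2,∞} ≤ μ. Suppose β > 0 is such that ‖A z‖₂ ≥ β·‖z‖_{2,q} for every z with ‖z‖_{2,1} ≤ 2·k^{1-1/q}·‖z‖_{2,q}. Then ‖x̂ − x‖_{2,q} ≤ 4·k^{1-1/q}·μ/β². -/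
open scoped BigOperators

noncomputable section

/-- Mixed ℓ₂/ℓ₁ norm of a block signal: sum of the Euclidean norms of the blocks. -/
def mnorm1 {p n : ℕ} (x : Fin p → EuclideanSpace ℝ (Fin n)) : ℝ := ∑ i, ‖x i‖

/-- Mixed ℓ₂/ℓ_q norm of a block signal. -/
def mnorm {p n : ℕ} (q : ℝ) (x : Fin p → EuclideanSpace ℝ (Fin n)) : ℝ :=
  (∑ i, ‖x i‖ ^ q) ^ (1 / q)

/-- Mixed ℓ₂/ℓ_∞ norm of a block signal: the largest block norm. -/
def mnormInf {p n : ℕ} (x : Fin p → EuclideanSpace ℝ (Fin n)) : ℝ := ⨆ i, ‖x i‖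

theorem norm_apply_le_mnormInf {p n : ℕ} (x : Fin p → EuclideanSpace ℝ (Fin n)) (i : Fin p) :
    ‖x i‖ ≤ mnormInf x :=
  le_ciSup (f := fun i => ‖x i‖) (Set.finite_range _).bddAbove i

theorem mnorm_nonneg {p n : ℕ} (q : ℝ) (x : Fin p → EuclideanSpace ℝ (Fin n)) :
    0 ≤ mnorm q x := by
  unfold mnorm; positivity

/-- Hölder's inequality on a set of at most `k` blocks. -/
theorem sum_norm_le_rpow_mul_mnorm {p n : ℕ} {q : ℝ} (hq : 1 < q) {k : ℕ}
    (x : Fin p → EuclideanSpace ℝ (Fin n)) {S : Finset (Fin p)} (hS : S.card ≤ k) :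
    ∑ i ∈ S, ‖x i‖ ≤ (k : ℝ) ^ (1 - 1 / q) * mnorm q x := by
  have hc := Real.HolderConjugate.conjExponent hq
  have h := Real.inner_le_Lp_mul_Lq S (fun _ => (1 : ℝ)) (fun i => ‖x i‖) hc.symm
  have he : 1 / q.conjExponent = 1 - 1 / q := by
    have := hc.inv_add_inv_eq_one
    simp only [one_div]; linarith
  have he0 : 0 ≤ 1 - 1 / q := by
    have : 1 / q ≤ 1 := by rw [div_le_one (by linarith)]; exact hq.le
    linarith
  simp only [one_mul, abs_one, Real.one_rpow, abs_norm, Finset.sum_const, nsmul_eq_mul, mul_one,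
    he] at h
  refine h.trans ?_
  unfold mnorm
  have hsub : ∑ i ∈ S, ‖x i‖ ^ q ≤ ∑ i, ‖x i‖ ^ q :=
    Finset.sum_le_sum_of_subset_of_nonneg (Finset.subset_univ S) fun i _ _ => by positivity
  have hk : (S.card : ℝ) ≤ k := by exact_mod_cast hS
  gcongr

/-- The cone condition: if `z` has mixed ℓ₂/ℓ₁ norm at most that of `x`, which is supported on `S`,
then at least half of the mixed norm of `z - x` is carried by `S`. -/
theorem mnorm1_sub_le_two_mul_sum {p n : ℕ} {x z : Fin p → EuclideanSpace ℝ (Fin n)}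
    {S : Finset (Fin p)} (hx : ∀ i ∉ S, x i = 0) (h : mnorm1 z ≤ mnorm1 x) :
    mnorm1 (fun i => z i - x i) ≤ 2 * ∑ i ∈ S, ‖z i - x i‖ := by
  unfold mnorm1 at *
  rw [← Finset.sum_add_sum_compl S] at h ⊢
  rw [← Finset.sum_add_sum_compl S (fun i => ‖x i‖)] at h
  have h1 : ∑ i ∈ Sᶜ, ‖x i‖ = 0 :=
    Finset.sum_eq_zero fun i hi => by simp [hx i (Finset.mem_compl.mp hi)]
  have h2 : ∑ i ∈ Sᶜ, ‖z i - x i‖ = ∑ i ∈ Sᶜ, ‖z i‖ :=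
    Finset.sum_congr rfl fun i hi => by simp [hx i (Finset.mem_compl.mp hi)]
  have h3 : ∑ i ∈ S, ‖x i‖ ≤ ∑ i ∈ S, ‖z i‖ + ∑ i ∈ S, ‖z i - x i‖ := by
    rw [← Finset.sum_add_distrib]
    refine Finset.sum_le_sum fun i _ => ?_
    have := norm_sub_norm_le (x i) (z i)
    rw [norm_sub_rev] at this
    linarith
  linarith

/-- Duality between the mixed ℓ₂/ℓ₁ and ℓ₂/ℓ_∞ norms. -/
theorem inner_le_mnorm1_mul {p n : ℕ} (x w : PiLp 2 (fun _ : Fin p => EuclideanSpace ℝ (Fin n)))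
    {c : ℝ} (hw : ∀ i, ‖w i‖ ≤ c) : inner ℝ x w ≤ mnorm1 x * c := by
  rw [PiLp.inner_apply, mnorm1, Finset.sum_mul]
  refine Finset.sum_le_sum fun i _ => (real_inner_le_norm _ _).trans ?_
  exact mul_le_mul_of_nonneg_left (hw i) (norm_nonneg _)

/-- Mixed ℓ₂/ℓ_q error bound for the block Dantzig selector with block k-sparse signals. -/
theorem stmt_7 {p n m : ℕ}
    (A : PiLp 2 (fun _ : Fin p => EuclideanSpace ℝ (Fin n)) →L[ℝ] EuclideanSpace ℝ (Fin m))
    (q : ℝ) (hq : 1 < q) (k : ℕ) (hk : 1 ≤ k)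
    (x : PiLp 2 (fun _ : Fin p => EuclideanSpace ℝ (Fin n)))
    (hx : ∃ S : Finset (Fin p), S.card ≤ k ∧ ∀ i ∉ S, x i = 0)
    (μ : ℝ) (hμ : 0 ≤ μ)
    (ε : EuclideanSpace ℝ (Fin m))
    (hε : mnormInf (ContinuousLinearMap.adjoint A ε) ≤ μ)
    (y : EuclideanSpace ℝ (Fin m)) (hy : y = A x + ε)
    (xh : PiLp 2 (fun _ : Fin p => EuclideanSpace ℝ (Fin n)))
    (hfeas : mnormInf (ContinuousLinearMap.adjoint A (y - A xh)) ≤ μ)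
    (hmin : ∀ z : PiLp 2 (fun _ : Fin p => EuclideanSpace ℝ (Fin n)),
      mnormInf (ContinuousLinearMap.adjoint A (y - A z)) ≤ μ → mnorm1 xh ≤ mnorm1 z)
    (β : ℝ) (hβ : 0 < β)
    (hcmsv : ∀ z : PiLp 2 (fun _ : Fin p => EuclideanSpace ℝ (Fin n)),
      mnorm1 z ≤ 2 * (k : ℝ) ^ (1 - 1 / q) * mnorm q z → β * mnorm q z ≤ ‖A z‖) :
    mnorm q (xh - x) ≤ 4 * (k : ℝ) ^ (1 - 1 / q) * μ / β ^ 2 := by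
  obtain ⟨S, hS, hxS⟩ := hx
  set h : PiLp 2 (fun _ : Fin p => EuclideanSpace ℝ (Fin n)) := xh - x with hh
  change mnorm q h ≤ _
  have hmin' : mnorm1 xh ≤ mnorm1 x := hmin x (by simpa [hy] using hε)
  have hcone : mnorm1 h ≤ 2 * (k : ℝ) ^ (1 - 1 / q) * mnorm q h := by
    have h1 : mnorm1 h ≤ 2 * ∑ i ∈ S, ‖h i‖ := mnorm1_sub_le_two_mul_sum hxS hmin'
    have h2 := sum_norm_le_rpow_mul_mnorm hq h hS
    linarith
  have hlow := hcmsv h hcone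
  have hres : ∀ i, ‖(ContinuousLinearMap.adjoint A (A h)) i‖ ≤ 2 * μ := fun i => by
    have hd : ContinuousLinearMap.adjoint A (A h) = ContinuousLinearMap.adjoint A ε -
        ContinuousLinearMap.adjoint A (y - A xh) := by
      rw [← map_sub, hy, hh, map_sub]
      congr 1
      abel
    rw [hd, PiLp.sub_apply]
    have h1 := (norm_apply_le_mnormInf _ i).trans hε
    have h2 := (norm_apply_le_mnormInf _ i).trans hfeas
    exact (norm_sub_le _ _).trans (by linarith)
  have hup : ‖A h‖ ^ 2 ≤ mnorm1 h * (2 * μ) := by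
    rw [← real_inner_self_eq_norm_sq, ← ContinuousLinearMap.adjoint_inner_right]
    exact inner_le_mnorm1_mul _ _ hres
  have hN := mnorm_nonneg q h
  rw [le_div_iff₀ (by positivity)]
  rcases hN.eq_or_lt with h0 | hpos
  · rw [← h0, zero_mul]
    positivity
  · refine le_of_mul_le_mul_right ?_ hpos
    calc mnorm q h * β ^ 2 * mnorm q h = (β * mnorm q h) ^ 2 := by ring
      _ ≤ ‖A h‖ ^ 2 := by gcongr
      _ ≤ mnorm1 h * (2 * μ) := hup
      _ ≤ 2 * (k : ℝ) ^ (1 - 1 / q) * mnorm q h * (2 * μ) := by gcongr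
      _ = 4 * (k : ℝ) ^ (1 - 1 / q) * μ * mnorm q h := by ring
end
end

section
/- For any real q with 1 < q < 2, any real s with 1 ≤ s ≤ p, and any linear measurement map A, β_{q,s}(A) ≥ s^{-1}·β_{2,s}(A). -/
open scoped BigOperators

noncomputable section

/-- The q-ratio block sparsity k_q(x) = (‖x‖_{2,1}/‖x‖_{2,q})^{q/(q-1)}. -/
def blockSparsity {p n : ℕ} (q : ℝ) (x : Fin p → EuclideanSpace ℝ (Fin n)) : ℝ :=
  (mnorm1 x / mnorm q x) ^ (q / (q - 1))

/-- The q-ratio block constrained minimal singular value of a measurement map. -/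
def bcmsv {p n m : ℕ} (q s : ℝ)
    (A : (Fin p → EuclideanSpace ℝ (Fin n)) →ₗ[ℝ] EuclideanSpace ℝ (Fin m)) : ℝ :=
  sInf {r : ℝ | ∃ z : Fin p → EuclideanSpace ℝ (Fin n),
    z ≠ 0 ∧ blockSparsity q z ≤ s ∧ r = ‖A z‖ / mnorm q z}

theorem exists_ne_zero_of_ne_zero {p n : ℕ} {z : Fin p → EuclideanSpace ℝ (Fin n)}
    (hz : z ≠ 0) : ∃ i, z i ≠ 0 := by
  by_contra! h
  exact hz (funext h)

theorem mnorm1_pos {p n : ℕ} {z : Fin p → EuclideanSpace ℝ (Fin n)} (hz : z ≠ 0) :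
    0 < mnorm1 z := by
  obtain ⟨i, hi⟩ := exists_ne_zero_of_ne_zero hz
  exact Finset.sum_pos' (fun _ _ => norm_nonneg _) ⟨i, Finset.mem_univ _, norm_pos_iff.2 hi⟩

theorem mnorm_pos {p n : ℕ} (q : ℝ) {z : Fin p → EuclideanSpace ℝ (Fin n)} (hz : z ≠ 0) :
    0 < mnorm q z := by
  obtain ⟨i, hi⟩ := exists_ne_zero_of_ne_zero hz
  refine Real.rpow_pos_of_pos (Finset.sum_pos' (fun _ _ => by positivity)
    ⟨i, Finset.mem_univ _, Real.rpow_pos_of_pos (norm_pos_iff.2 hi) _⟩) _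

theorem sum_norm_div_mnorm1 {p n : ℕ} {z : Fin p → EuclideanSpace ℝ (Fin n)} (hz : z ≠ 0) :
    ∑ i, ‖z i‖ / mnorm1 z = 1 := by
  rw [← Finset.sum_div]
  exact div_self (mnorm1_pos hz).ne'

/-- The mixed norm factors through the normalized block norms `‖z i‖ / mnorm1 z`. -/
theorem mnorm_eq_mnorm1_mul {p n : ℕ} {q : ℝ} (hq : q ≠ 0)
    {z : Fin p → EuclideanSpace ℝ (Fin n)} (hz : z ≠ 0) :
    mnorm q z = mnorm1 z * (∑ i, (‖z i‖ / mnorm1 z) ^ q) ^ (1 / q) := by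
  have h1 := mnorm1_pos hz
  have hsum : ∑ i, ‖z i‖ ^ q = mnorm1 z ^ q * ∑ i, (‖z i‖ / mnorm1 z) ^ q := by
    rw [Finset.mul_sum]
    refine Finset.sum_congr rfl fun i _ => ?_
    rw [← Real.mul_rpow h1.le (by positivity), mul_div_cancel₀ _ h1.ne']
  rw [mnorm, hsum, Real.mul_rpow (by positivity)
    (Finset.sum_nonneg fun _ _ => by positivity), ← Real.rpow_mul h1.le,
    mul_one_div_cancel hq, Real.rpow_one]

theorem blockSparsity_eq_inv_rpow {p n : ℕ} {q : ℝ} (hq : 1 < q)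
    {z : Fin p → EuclideanSpace ℝ (Fin n)} (hz : z ≠ 0) :
    blockSparsity q z = ((∑ i, (‖z i‖ / mnorm1 z) ^ q) ^ (1 / (q - 1)))⁻¹ := by
  have h1 := mnorm1_pos hz
  have hq0 : q ≠ 0 := by linarith
  have hq1 : q - 1 ≠ 0 := by linarith
  have hT : 0 ≤ ∑ i, (‖z i‖ / mnorm1 z) ^ q := Finset.sum_nonneg fun _ _ => by positivity
  rw [blockSparsity, mnorm_eq_mnorm1_mul hq0 hz, div_mul_cancel_left₀ h1.ne',
    Real.inv_rpow (by positivity), ← Real.rpow_mul hT]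
  congr 2
  field_simp

/-- The block sparsity is nonincreasing in `q`, here between `q ∈ (1, 2)` and `2`. -/
theorem blockSparsity_two_le {p n : ℕ} {q : ℝ} (hq1 : 1 < q) (hq2 : q < 2)
    {z : Fin p → EuclideanSpace ℝ (Fin n)} (hz : z ≠ 0) :
    blockSparsity 2 z ≤ blockSparsity q z := by
  have h1 := mnorm1_pos hz
  have hq0 : 0 < q - 1 := by linarith
  obtain ⟨i, hi⟩ := exists_ne_zero_of_ne_zero hz
  have hi' : 0 < ‖z i‖ := norm_pos_iff.2 hi
  have hT : 0 < ∑ i, (‖z i‖ / mnorm1 z) ^ q :=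
    Finset.sum_pos' (fun _ _ => by positivity)
      ⟨i, Finset.mem_univ _, Real.rpow_pos_of_pos (div_pos hi' h1) _⟩
  rw [blockSparsity_eq_inv_rpow hq1 hz, blockSparsity_eq_inv_rpow one_lt_two hz]
  refine inv_anti₀ (Real.rpow_pos_of_pos hT _) ?_
  have jensen := Real.rpow_arith_mean_le_arith_mean_rpow Finset.univ
    (fun i => ‖z i‖ / mnorm1 z) (fun i => (‖z i‖ / mnorm1 z) ^ (q - 1))
    (fun _ _ => by positivity) (sum_norm_div_mnorm1 hz) (fun _ _ => by positivity)
    (p := 1 / (q - 1)) (by rw [le_div_iff₀ hq0]; linarith)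
  have hleft : ∀ t : ℝ, 0 ≤ t → t * t ^ (q - 1) = t ^ q := fun t ht => by
    rw [← Real.rpow_one_add' ht (by linarith)]
    congr 1
    ring
  have hright : ∀ t : ℝ, 0 ≤ t → t * (t ^ (q - 1)) ^ (1 / (q - 1)) = t ^ (2 : ℝ) :=
    fun t ht => by
      rw [← Real.rpow_mul ht, mul_one_div_cancel hq0.ne', Real.rpow_one, Real.rpow_two, sq]
  have hexp : (1 : ℝ) / (2 - 1) = 1 := by norm_num
  rw [hexp, Real.rpow_one]
  calc (∑ i, (‖z i‖ / mnorm1 z) ^ q) ^ (1 / (q - 1))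
      = (∑ i, ‖z i‖ / mnorm1 z * (‖z i‖ / mnorm1 z) ^ (q - 1)) ^ (1 / (q - 1)) := by
        congr 1
        exact Finset.sum_congr rfl fun i _ => (hleft _ (by positivity)).symm
    _ ≤ _ := jensen
    _ = _ := Finset.sum_congr rfl fun i _ => hright _ (by positivity)

theorem mnorm_le_mnorm1 {p n : ℕ} {q : ℝ} (hq : 1 ≤ q)
    {z : Fin p → EuclideanSpace ℝ (Fin n)} (hz : z ≠ 0) : mnorm q z ≤ mnorm1 z := by
  have h1 := mnorm1_pos hz
  rw [mnorm_eq_mnorm1_mul (by linarith) hz]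
  refine mul_le_of_le_one_right h1.le (Real.rpow_le_one
    (Finset.sum_nonneg fun _ _ => by positivity) ?_ (by positivity))
  rw [← sum_norm_div_mnorm1 hz]
  refine Finset.sum_le_sum fun i _ => Real.rpow_le_self_of_le_one (by positivity) ?_ hq
  rw [div_le_one h1]
  exact Finset.single_le_sum (f := fun i => ‖z i‖) (fun _ _ => norm_nonneg _)
    (Finset.mem_univ i)

theorem mnorm1_le_mul_mnorm_two {p n : ℕ} {s : ℝ} (hs : 1 ≤ s)
    {z : Fin p → EuclideanSpace ℝ (Fin n)} (hz : z ≠ 0) (h : blockSparsity 2 z ≤ s) :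
    mnorm1 z ≤ s * mnorm 2 z := by
  have hexp : (2 : ℝ) / (2 - 1) = 2 := by norm_num
  rw [blockSparsity, hexp, Real.rpow_two] at h
  rw [← div_le_iff₀ (mnorm_pos 2 hz)]
  nlinarith

theorem blockSparsity_single {p n : ℕ} {q : ℝ} (hq : 1 < q) (i : Fin p)
    {v : EuclideanSpace ℝ (Fin n)} (hv : v ≠ 0) :
    blockSparsity q (Pi.single i v : Fin p → EuclideanSpace ℝ (Fin n)) = 1 := by
  have hnorm : ∀ j, ‖(Pi.single i v : Fin p → EuclideanSpace ℝ (Fin n)) j‖ =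
      if j = i then ‖v‖ else 0 := fun j => by
    rw [Pi.single_apply]
    split_ifs <;> simp
  have hq0 : q ≠ 0 := by linarith
  have h1 : mnorm1 (Pi.single i v : Fin p → EuclideanSpace ℝ (Fin n)) = ‖v‖ := by
    simp [mnorm1, hnorm]
  have h2 : mnorm q (Pi.single i v : Fin p → EuclideanSpace ℝ (Fin n)) = ‖v‖ := by
    simp [mnorm, hnorm, apply_ite (· ^ q), Real.zero_rpow hq0,
      Real.rpow_rpow_inv (norm_nonneg v) hq0]
  rw [blockSparsity, h1, h2, div_self (norm_ne_zero_iff.2 hv), Real.one_rpow]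

theorem bcmsv_le {p n m : ℕ} {q s : ℝ}
    (A : (Fin p → EuclideanSpace ℝ (Fin n)) →ₗ[ℝ] EuclideanSpace ℝ (Fin m))
    {z : Fin p → EuclideanSpace ℝ (Fin n)} (hz : z ≠ 0) (h : blockSparsity q z ≤ s) :
    bcmsv q s A ≤ ‖A z‖ / mnorm q z := by
  refine csInf_le ⟨0, ?_⟩ ⟨z, hz, h, rfl⟩
  rintro r ⟨w, hw, -, rfl⟩
  exact div_nonneg (norm_nonneg _) (mnorm_pos q hw).le

/-- For 1 < q < 2 and 1 ≤ s ≤ p : β_{q,s}(A) ≥ s⁻¹·β_{2,s}(A). -/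
theorem stmt_15 {p n m : ℕ}
    (A : (Fin p → EuclideanSpace ℝ (Fin n)) →ₗ[ℝ] EuclideanSpace ℝ (Fin m))
    (q : ℝ) (hq1 : 1 < q) (hq2 : q < 2)
    (s : ℝ) (hs1 : 1 ≤ s) (hs2 : s ≤ (p : ℝ)) :
    s⁻¹ * bcmsv 2 s A ≤ bcmsv q s A := by
  by_cases hex : ∃ z : Fin p → EuclideanSpace ℝ (Fin n), z ≠ 0
  · obtain ⟨z₀, hz₀⟩ := hex
    obtain ⟨i, hi⟩ := exists_ne_zero_of_ne_zero hz₀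
    refine le_csInf ⟨_, Pi.single i (z₀ i), by simpa using hi,
      (blockSparsity_single hq1 i hi).trans_le hs1, rfl⟩ ?_
    rintro r ⟨z, hz, hzs, rfl⟩
    have hs0 : 0 < s := by linarith
    have h2s := (blockSparsity_two_le hq1 hq2 hz).trans hzs
    have hle : mnorm q z ≤ s * mnorm 2 z :=
      (mnorm_le_mnorm1 hq1.le hz).trans (mnorm1_le_mul_mnorm_two hs1 hz h2s)
    calc s⁻¹ * bcmsv 2 s A ≤ s⁻¹ * (‖A z‖ / mnorm 2 z) := by
          gcongr
          exact bcmsv_le A hz h2s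
      _ = ‖A z‖ / (s * mnorm 2 z) := by
          rw [inv_mul_eq_div, div_div, mul_comm]
      _ ≤ ‖A z‖ / mnorm q z :=
          div_le_div_of_nonneg_left (norm_nonneg _) (mnorm_pos q hz) hle
  · push Not at hex
    have hempty : ∀ q' : ℝ, bcmsv q' s A = 0 := fun q' => by
      rw [bcmsv, ← Real.sInf_empty]
      congr 1
      rw [Set.eq_empty_iff_forall_notMem]
      rintro r ⟨z, hz, -⟩
      exact hz (hex z)
    simp [hempty]
end
end
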